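/- Suppose the smooth functions on U satisfy the Wirtinger-angle equations (W), the two Codazzi equations (C2) and (C3) with S = −T, and the Gauss equation (G). Then the Ricci equation (R) holds on U. (This is the analytic core of the theorem that for any Lorentz surface in any Lorentzian Kaehler surface, the equation of Ricci is a consequence of the equations of Gauss and Codazzi; the hypothesis S = −T expresses the ambient curvature identity R̃(e₂,e₁;e₁,Je₂) = −R̃(e₁,e₂;e₂,Je₁) that follows from the indefinite-Kaehler curvature symmetries.) -/

import Mathlib

/-- Partial derivative in the `x` direction. -/
noncomputable def pd1 (f : ℝ × ℝ → ℝ) (p : ℝ × ℝ) : ℝ := fderiv ℝ f p (1, 0)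

/-- Partial derivative in the `y` direction. -/
noncomputable def pd2 (f : ℝ × ℝ → ℝ) (p : ℝ × ℝ) : ℝ := fderiv ℝ f p (0, 1)

/-- if the Wirtinger-angle equations (W), the Codazzi equations (C2), (C3)
with `S = −T`, and the Gauss equation (G) hold on `U`, then the Ricci equation (R) holds
on `U`. (The Ricci equation is a consequence of the Gauss and Codazzi equations for
Lorentz surfaces in Lorentzian Kaehler surfaces.) -/
theorem stmt_11 (U : Set (ℝ × ℝ)) (hU : IsOpen U)
    (m α β γ δ φ lam μ K T S : ℝ × ℝ → ℝ)
    (hm : ContDiffOn ℝ (⊤ : ℕ∞) m U) (hα : ContDiffOn ℝ (⊤ : ℕ∞) α U) (hβ : ContDiffOn ℝ (⊤ : ℕ∞) β U)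
    (hγ : ContDiffOn ℝ (⊤ : ℕ∞) γ U) (hδ : ContDiffOn ℝ (⊤ : ℕ∞) δ U) (hφ : ContDiffOn ℝ (⊤ : ℕ∞) φ U)
    (hlam : ContDiffOn ℝ (⊤ : ℕ∞) lam U) (hμ : ContDiffOn ℝ (⊤ : ℕ∞) μ U) (hK : ContDiffOn ℝ (⊤ : ℕ∞) K U)
    (hT : ContDiffOn ℝ (⊤ : ℕ∞) T U) (hS : ContDiffOn ℝ (⊤ : ℕ∞) S U)
    (hmpos : ∀ p ∈ U, 0 < m p)
    (hW1 : ∀ p ∈ U, pd1 α p = m p * (φ p - β p))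
    (hW2 : ∀ p ∈ U, pd2 α p = m p * (μ p - δ p))
    (hC2 : ∀ p ∈ U, pd1 μ p - pd2 φ p
      = (δ p * φ p - β p * μ p) * m p * Real.tanh (α p)
        + (φ p * pd2 m p - μ p * pd1 m p) / m p
        - m p * (Real.cosh (α p))⁻¹ * T p - m p * Real.tanh (α p) * K p)
    (hC3 : ∀ p ∈ U, pd2 β p - pd1 δ p
      = (β p * μ p - δ p * φ p) * m p * Real.tanh (α p)
        + (δ p * pd1 m p - β p * pd2 m p) / m p
        - m p * (Real.cosh (α p))⁻¹ * S p + m p * Real.tanh (α p) * K p)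
    (hST : ∀ p ∈ U, S p = -T p)
    (hG : ∀ p ∈ U, γ p * lam p + β p * μ p - 2 * δ p * φ p
      = 2 * (m p * pd2 (pd1 m) p - pd1 m p * pd2 m p) / (m p)^4 - K p) :
    ∀ p ∈ U,
      2 * (m p * pd2 (pd1 m) p - pd1 m p * pd2 m p) / (m p)^4
        + ((δ p + μ p) * pd1 α p - (β p + φ p) * pd2 α p) * ((Real.cosh (α p))⁻¹)^2 / m p
        + ((δ p + μ p) * pd1 m p - (β p + φ p) * pd2 m p
            + m p * (pd1 δ p + pd1 μ p - pd2 β p - pd2 φ p)) * Real.tanh (α p) / (m p)^2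
      = γ p * lam p - β p * μ p
        + (((Real.cosh (α p))⁻¹)^2 - (Real.tanh (α p))^2) * K p
        - 2 * (Real.cosh (α p))⁻¹ * Real.tanh (α p) * T p := by
  intro p hp
  have hm0 : m p ≠ 0 := (hmpos p hp).ne'
  have hst : ((Real.cosh (α p))⁻¹) ^ 2 + Real.tanh (α p) ^ 2 = 1 := by
    have hc : Real.cosh (α p) ≠ 0 := (Real.cosh_pos _).ne'
    rw [Real.tanh_eq_sinh_div_cosh]
    field_simp
    linarith [Real.cosh_sq (α p)]
  have h2 := hC2 p hp
  have h3 := hC3 p hp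
  have hg := hG p hp
  rw [hST p hp] at h3
  rw [hW1 p hp, hW2 p hp]
  generalize (Real.cosh (α p))⁻¹ = s at *
  generalize Real.tanh (α p) = t at *
  have hsum : pd1 δ p + pd1 μ p - pd2 β p - pd2 φ p
      = 2 * (δ p * φ p - β p * μ p) * m p * t
        + ((φ p + β p) * pd2 m p - (μ p + δ p) * pd1 m p) / m p
        - 2 * m p * s * T p - 2 * m p * t * K p := by
    linear_combination h2 - h3
  have hangle : ((δ p + μ p) * (m p * (φ p - β p)) - (β p + φ p) * (m p * (μ p - δ p)))
      * s ^ 2 / m p = 2 * (δ p * φ p - β p * μ p) * s ^ 2 := by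
    field_simp
    ring
  have hderiv : ((δ p + μ p) * pd1 m p - (β p + φ p) * pd2 m p
      + m p * (pd1 δ p + pd1 μ p - pd2 β p - pd2 φ p)) * t / (m p) ^ 2
      = 2 * (δ p * φ p - β p * μ p) * t ^ 2 - 2 * s * t * T p - 2 * t ^ 2 * K p := by
    rw [hsum]
    field_simp
    ring
  rw [hangle, hderiv]
  linear_combination (2 * (δ p * φ p - β p * μ p) - K p) * hst - hg
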